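/- For all integers t ≥ 1, s ≥ max(t, 2) and m ≥ 2s: the blow-up of F_5 in which every vertex is replaced by t copies is a subhypergraph of F_5^S(m,t,K_{s,s}). Specifically, the blow-ups of f_1 and f_2 can be embedded into the two parts of T_3(3m,3) not containing S_0 or S_1, the blow-up of f_3 into S_0, the blow-up of f_4 into S_1, and the blow-up of f_5 into T. -/

import Mathlib

open Finset

/-- `H` (a 3-graph given by its edge set on vertex type `V`) contains a copy of the
3-graph `F` (given by its edge set on vertex type `W`). -/
def HasCopy {V W : Type*} [DecidableEq V] [DecidableEq W]
    (H : Finset (Finset V)) (F : Finset (Finset W)) : Prop :=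
  ∃ f : W ↪ V, ∀ e ∈ F, e.image f ∈ H

/-- The Turán number `ex_3(n, F)`: the maximum number of hyperedges of an `F`-free
3-uniform hypergraph on `n` vertices. -/
noncomputable def exThree {W : Type*} [DecidableEq W] (n : ℕ) (F : Finset (Finset W)) : ℕ :=
  sSup {k | ∃ H : Finset (Finset (Fin n)), (∀ e ∈ H, e.card = 3) ∧ ¬ HasCopy H F ∧ H.card = k}

/-- The `i`-th part of the balanced tripartition of `Fin n` (vertices with residue `i` mod 3);
the parts have sizes `⌊n/3⌋` or `⌈n/3⌉`. -/
def turanPart (n : ℕ) (i : Fin 3) : Finset (Fin n) :=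
  Finset.univ.filter (fun v => (v : ℕ) % 3 = (i : ℕ))

/-- The balanced complete tripartite 3-graph `T_3(n,3)`: hyperedges are exactly the triples
with one vertex in each part of the balanced tripartition. -/
def T3 (n : ℕ) : Finset (Finset (Fin n)) :=
  Finset.univ.filter (fun e => e.card = 3 ∧ ∀ i : Fin 3, (e ∩ turanPart n i).card = 1)

/-- The 3-graph `F_5` on `{f_1, …, f_5}` with hyperedges `f_1f_2f_3, f_1f_2f_4, f_3f_4f_5`. -/
def F5 : Finset (Finset (Fin 5)) := {{0,1,2},{0,1,3},{2,3,4}}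

/-- `F_5(f_5;t)`: `F_5` with the vertex `f_5` blown up to `t` copies.
Here `inl 0, inl 1, inl 2, inl 3` play the roles of `f_1,f_2,f_3,f_4` and the
vertices `inr j` are the `t` copies of `f_5`. -/
def F5b5 (t : ℕ) : Finset (Finset (Fin 4 ⊕ Fin t)) :=
  ({({Sum.inl 0, Sum.inl 1, Sum.inl 2} : Finset (Fin 4 ⊕ Fin t)),
    ({Sum.inl 0, Sum.inl 1, Sum.inl 3} : Finset (Fin 4 ⊕ Fin t))} :
      Finset (Finset (Fin 4 ⊕ Fin t))) ∪
  Finset.univ.image (fun j : Fin t => ({Sum.inl 2, Sum.inl 3, Sum.inr j} : Finset (Fin 4 ⊕ Fin t)))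

/-- `F_5(f_3;t)`: `F_5` with the vertex `f_3` blown up to `t` copies.
Here `inl 0, inl 1, inl 2, inl 3` play the roles of `f_1,f_2,f_4,f_5` and the
vertices `inr j` are the `t` copies of `f_3`. -/
def F5b3 (t : ℕ) : Finset (Finset (Fin 4 ⊕ Fin t)) :=
  ({({Sum.inl 0, Sum.inl 1, Sum.inl 2} : Finset (Fin 4 ⊕ Fin t))} :
      Finset (Finset (Fin 4 ⊕ Fin t))) ∪
  Finset.univ.image (fun j : Fin t => ({Sum.inl 0, Sum.inl 1, Sum.inr j} : Finset (Fin 4 ⊕ Fin t))) ∪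
  Finset.univ.image (fun j : Fin t => ({Sum.inr j, Sum.inl 2, Sum.inl 3} : Finset (Fin 4 ⊕ Fin t)))

/-- `S^t(N)` (the size of `D(N,3,t,2)`): the maximum number of hyperedges of a 3-graph on `N`
vertices in which every pair of vertices is contained in at most `t-1` hyperedges. -/
noncomputable def Dmax (N t : ℕ) : ℕ :=
  sSup {k | ∃ H : Finset (Finset (Fin N)), (∀ e ∈ H, e.card = 3) ∧
    (∀ u v : Fin N, u ≠ v → (H.filter (fun e => u ∈ e ∧ v ∈ e)).card ≤ t - 1) ∧ H.card = k}

/-- `e(T_3(n,3)^{t+})`: the number of hyperedges of `T_3(n,3)` together with a maximum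
3-graph inside each part in which every pair of vertices lies in at most `t-1` hyperedges. -/
noncomputable def eT3plus (n t : ℕ) : ℕ :=
  (T3 n).card + ∑ i : Fin 3, Dmax ((turanPart n i).card) t

/-- `F` is a subgraph of a blow-up of `F_5`: every edge is a triple, and there is a map
to `V(F_5)` that is injective on each edge and sends each edge to an edge of `F_5`. -/
def IsSubBlowupF5 {W : Type*} [DecidableEq W] (F : Finset (Finset W)) : Prop :=
  (∀ e ∈ F, e.card = 3) ∧ ∃ φ : W → Fin 5, ∀ e ∈ F, (e.image φ).card = 3 ∧ e.image φ ∈ F5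

/-- The complete tripartite 3-graph with parts `A`, `B`, `C`: all triples with exactly
one vertex in each of `A`, `B`, `C`. -/
def tripartiteEdges {n : ℕ} (A B C : Finset (Fin n)) : Finset (Finset (Fin n)) :=
  Finset.univ.filter (fun e =>
    (e ∩ A).card = 1 ∧ (e ∩ B).card = 1 ∧ (e ∩ C).card = 1 ∧ e.card = 3)

/-- The complete 3-partite 3-graph `K_{t,s,s}` with parts of sizes `t`, `s`, `s`. -/
def Ktss (t s : ℕ) : Finset (Finset (Fin t ⊕ Fin s ⊕ Fin s)) :=
  Finset.univ.image (fun x : Fin t × Fin s × Fin s =>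
    ({Sum.inl x.1, Sum.inr (Sum.inl x.2.1), Sum.inr (Sum.inr x.2.2)} :
      Finset (Fin t ⊕ Fin s ⊕ Fin s)))

/-- All hyperedges of `H` consist of one vertex of the `A`-side (`Fin mA`) and two
vertices of the `B`-side (`Fin nB`). -/
def BipShape (mA nB : ℕ) (H : Finset (Finset (Fin mA ⊕ Fin nB))) : Prop :=
  ∀ e ∈ H, ∃ a : Fin mA, ∃ b c : Fin nB, b ≠ c ∧
    e = ({Sum.inl a, Sum.inr b, Sum.inr c} : Finset (Fin mA ⊕ Fin nB))

/-- `H` contains a copy of `K_{t,s,s}` whose `t`-vertex part lies on the `A`-side and whose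
two `s`-vertex parts lie on the `B`-side. -/
def HasBipKtss (mA nB t s : ℕ) (H : Finset (Finset (Fin mA ⊕ Fin nB))) : Prop :=
  ∃ (T : Finset (Fin mA)) (S0 S1 : Finset (Fin nB)), T.card = t ∧
    S0.card = s ∧ S1.card = s ∧ Disjoint S0 S1 ∧
    ∀ a ∈ T, ∀ b ∈ S0, ∀ c ∈ S1,
      ({Sum.inl a, Sum.inr b, Sum.inr c} : Finset (Fin mA ⊕ Fin nB)) ∈ H

/-- The bipartite Turán number `ex_3^{bip}(mA, nB, K_{t,s,s})`. -/
noncomputable def exBip (mA nB t s : ℕ) : ℕ :=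
  sSup {k | ∃ H : Finset (Finset (Fin mA ⊕ Fin nB)),
    BipShape mA nB H ∧ ¬ HasBipKtss mA nB t s H ∧ H.card = k}

/-- The `s`-set `S_0` inside the residue-0 part of `T_3(3m,3)`. -/
def S0set (m s : ℕ) (h : 2*s ≤ m) : Finset (Fin (3*m)) :=
  Finset.univ.image (fun i : Fin s => (⟨3*i.val, by have := i.isLt; omega⟩ : Fin (3*m)))

/-- The `s`-set `S_1` inside the residue-0 part of `T_3(3m,3)`, disjoint from `S_0`. -/
def S1set (m s : ℕ) (h : 2*s ≤ m) : Finset (Fin (3*m)) :=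
  Finset.univ.image (fun i : Fin s => (⟨3*(s+i.val), by have := i.isLt; omega⟩ : Fin (3*m)))

/-- The 3-graph `F_5^S(m,t,K_{s,s})`: `T_3(3m,3)` (on the `inl` vertices) together with a set
`T` of `t` new vertices (the `inr` vertices) and all triples consisting of one vertex of `T`,
one vertex of `S_0` and one vertex of `S_1`. -/
def F5Stss (m t s : ℕ) (h : 2*s ≤ m) : Finset (Finset (Fin (3*m) ⊕ Fin t)) :=
  (T3 (3*m)).image (fun e => e.image Sum.inl) ∪
  Finset.univ.biUnion (fun j : Fin t =>
    ((S0set m s h) ×ˢ (S1set m s h)).image (fun p =>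
      ({Sum.inr j, Sum.inl p.1, Sum.inl p.2} : Finset (Fin (3*m) ⊕ Fin t))))

/-- `F_sim(t)`: the 3-graph with hyperedges `f_1f_2f_3, f_1f_2f_4, f_3f_4f_5, f_5f_6f_7,
f_6f_7f_8` in which `f_8` is blown up to `t` copies. Here `inl 0, …, inl 6` play the roles
of `f_1, …, f_7` and the vertices `inr j` are the `t` copies of `f_8`. -/
def Fsim (t : ℕ) : Finset (Finset (Fin 7 ⊕ Fin t)) :=
  ({({Sum.inl 0, Sum.inl 1, Sum.inl 2} : Finset (Fin 7 ⊕ Fin t)),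
    ({Sum.inl 0, Sum.inl 1, Sum.inl 3} : Finset (Fin 7 ⊕ Fin t)),
    ({Sum.inl 2, Sum.inl 3, Sum.inl 4} : Finset (Fin 7 ⊕ Fin t)),
    ({Sum.inl 4, Sum.inl 5, Sum.inl 6} : Finset (Fin 7 ⊕ Fin t))} :
      Finset (Finset (Fin 7 ⊕ Fin t))) ∪
  Finset.univ.image (fun j : Fin t => ({Sum.inl 5, Sum.inl 6, Sum.inr j} : Finset (Fin 7 ⊕ Fin t)))

/-- The 3-graph with parts `A`, `B`, `C` and an extra clique `X`: its hyperedges are the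
triples with one vertex in each of `A`, `B`, `C`, all 3-subsets of `X`, and the triples with
one vertex in `X` and two vertices in a common part among `A`, `B`, `C`. -/
def simConstr (n : ℕ) (A B C X : Finset (Fin n)) : Finset (Finset (Fin n)) :=
  Finset.univ.filter (fun e => e.card = 3 ∧
    (((e ∩ A).card = 1 ∧ (e ∩ B).card = 1 ∧ (e ∩ C).card = 1) ∨
     e ⊆ X ∨
     ((e ∩ X).card = 1 ∧ ((e ∩ A).card = 2 ∨ (e ∩ B).card = 2 ∨ (e ∩ C).card = 2))))

/-- `F_5^S(m)`: `T_3(3m,3)` together with one new vertex `v = inr ()` and one hyperedge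
consisting of `v` and two vertices (`0` and `3`) lying in one part of `T_3(3m,3)`. -/
def F5Sm (m : ℕ) (hm : 2 ≤ m) : Finset (Finset (Fin (3*m) ⊕ Unit)) :=
  (T3 (3*m)).image (fun e => e.image Sum.inl) ∪
  {({Sum.inr (), Sum.inl ⟨0, by omega⟩, Sum.inl ⟨3, by omega⟩} : Finset (Fin (3*m) ⊕ Unit))}

/-- The disjoint union of `k` vertex-disjoint copies of the 3-graph `F`. -/
def copies (k : ℕ) {W : Type*} [DecidableEq W] (F : Finset (Finset W)) :
    Finset (Finset (Fin k × W)) :=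
  Finset.univ.biUnion (fun j : Fin k => F.image (fun e => e.image (fun w => (j, w))))

/-- The 3-graph `G(t,m,n)` (it does not depend on `m`): the vertices `v < t` form the set
`T`, the remaining `n - t` vertices carry a copy of `T_3(n-t,3)` (parts by residue of
`v - t` mod 3), and the hyperedges are those of this `T_3(n-t,3)` together with all
3-sets of vertices intersecting `T`. -/
def Gtmn (t n : ℕ) : Finset (Finset (Fin n)) :=
  Finset.univ.filter (fun e => e.card = 3 ∧
    ((∃ v ∈ e, (v : ℕ) < t) ∨
     (∀ i : Fin 3, (e.filter (fun v : Fin n => t ≤ (v : ℕ) ∧ ((v : ℕ) - t) % 3 = (i : ℕ))).card = 1)))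

/-- The blow-up of `F_5` in which every vertex is replaced by `t` copies:
the vertex `(i, j)` is the `j`-th copy of `f_{i+1}`. -/
def F5blowAll (t : ℕ) : Finset (Finset (Fin 5 × Fin t)) :=
  Finset.univ.biUnion (fun x : Fin t × Fin t × Fin t =>
    ({ ({((0:Fin 5), x.1), ((1:Fin 5), x.2.1), ((2:Fin 5), x.2.2)} : Finset (Fin 5 × Fin t)),
       ({((0:Fin 5), x.1), ((1:Fin 5), x.2.1), ((3:Fin 5), x.2.2)} : Finset (Fin 5 × Fin t)),
       ({((2:Fin 5), x.1), ((3:Fin 5), x.2.1), ((4:Fin 5), x.2.2)} : Finset (Fin 5 × Fin t)) } :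
      Finset (Finset (Fin 5 × Fin t))))

/-- A triple with one vertex in each residue class modulo `3` is a hyperedge of `T3 n`. -/
theorem triple_mem_T3 {n : ℕ} {a b c : Fin n} (ha : (a : ℕ) % 3 = 1) (hb : (b : ℕ) % 3 = 2)
    (hc : (c : ℕ) % 3 = 0) : ({a, b, c} : Finset (Fin n)) ∈ T3 n := by
  have hab : a ≠ b := by rintro rfl; omega
  have hac : a ≠ c := by rintro rfl; omega
  have hbc : b ≠ c := by rintro rfl; omega
  refine Finset.mem_filter.2 ⟨Finset.mem_univ _, Finset.card_eq_three.2 ⟨a, b, c, hab, hac, hbc, rfl⟩,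
    fun i => ?_⟩
  rw [turanPart, ← Finset.filter_mem_eq_inter]
  fin_cases i <;> simp [Finset.filter_insert, Finset.filter_singleton, ha, hb, hc]

theorem triple_inl_mem_F5Stss {m t s : ℕ} (h : 2 * s ≤ m) {a b c : Fin (3 * m)}
    (ha : (a : ℕ) % 3 = 1) (hb : (b : ℕ) % 3 = 2) (hc : (c : ℕ) % 3 = 0) :
    ({Sum.inl a, Sum.inl b, Sum.inl c} : Finset (Fin (3 * m) ⊕ Fin t)) ∈ F5Stss m t s h :=
  Finset.mem_union_left _ <|
    Finset.mem_image.2 ⟨{a, b, c}, triple_mem_T3 ha hb hc, by simp [Finset.image_insert]⟩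

theorem triple_inr_mem_F5Stss {m t s : ℕ} (h : 2 * s ≤ m) {a b : Fin (3 * m)} (j : Fin t)
    (ha : a ∈ S0set m s h) (hb : b ∈ S1set m s h) :
    ({Sum.inl a, Sum.inl b, Sum.inr j} : Finset (Fin (3 * m) ⊕ Fin t)) ∈ F5Stss m t s h := by
  refine Finset.mem_union_right _ <| Finset.mem_biUnion.2 ⟨j, Finset.mem_univ _,
    Finset.mem_image.2 ⟨(a, b), Finset.mem_product.2 ⟨ha, hb⟩, ?_⟩⟩
  ext x
  simp only [Finset.mem_insert, Finset.mem_singleton]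
  tauto

/-- The map on the vertices of the blow-up of `F5` sending the copies of `f_1`, `f_2` into the
residue classes `1`, `2`, those of `f_3`, `f_4` into `S0set`, `S1set`, and those of `f_5` to the
new vertices. -/
def blowupMap (t s m : ℕ) (hts : t ≤ s) (hm : 2 * s ≤ m) (x : Fin 5 × Fin t) :
    Fin (3 * m) ⊕ Fin t :=
  ![Sum.inl ⟨3 * x.2 + 1, by omega⟩, Sum.inl ⟨3 * x.2 + 2, by omega⟩,
    Sum.inl ⟨3 * x.2, by omega⟩, Sum.inl ⟨3 * (s + x.2), by omega⟩, Sum.inr x.2] x.1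

theorem blowupMap_injective (t s m : ℕ) (hts : t ≤ s) (hm : 2 * s ≤ m) :
    Function.Injective (blowupMap t s m hts hm) := by
  rintro ⟨i, j⟩ ⟨i', j'⟩ h
  fin_cases i <;> fin_cases i' <;> simp [blowupMap, Fin.ext_iff] at h ⊢ <;> omega

theorem statement19 (t s m : ℕ) (ht : 1 ≤ t) (hs : 2 ≤ s) (hts : t ≤ s) (hm : 2*s ≤ m) :
    ∃ f : (Fin 5 × Fin t) ↪ (Fin (3*m) ⊕ Fin t),
      (∀ e ∈ F5blowAll t, e.image f ∈ F5Stss m t s hm) ∧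
      (∀ j : Fin t, ∃ v : Fin (3*m), f ((0 : Fin 5), j) = Sum.inl v ∧ (v : ℕ) % 3 = 1) ∧
      (∀ j : Fin t, ∃ v : Fin (3*m), f ((1 : Fin 5), j) = Sum.inl v ∧ (v : ℕ) % 3 = 2) ∧
      (∀ j : Fin t, ∃ v ∈ S0set m s hm, f ((2 : Fin 5), j) = Sum.inl v) ∧
      (∀ j : Fin t, ∃ v ∈ S1set m s hm, f ((3 : Fin 5), j) = Sum.inl v) ∧
      (∀ j : Fin t, ∃ k : Fin t, f ((4 : Fin 5), j) = Sum.inr k) := by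
  have h0 (j : Fin t) : (⟨3 * j, by omega⟩ : Fin (3 * m)) ∈ S0set m s hm :=
    Finset.mem_image.2 ⟨⟨j, by omega⟩, Finset.mem_univ _, rfl⟩
  have h1 (j : Fin t) : (⟨3 * (s + j), by omega⟩ : Fin (3 * m)) ∈ S1set m s hm :=
    Finset.mem_image.2 ⟨⟨j, by omega⟩, Finset.mem_univ _, rfl⟩
  refine ⟨⟨blowupMap t s m hts hm, blowupMap_injective t s m hts hm⟩, fun e he => ?_,
    fun j => ⟨_, rfl, by simp⟩, fun j => ⟨_, rfl, by simp⟩,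
    fun j => ⟨_, h0 j, rfl⟩, fun j => ⟨_, h1 j, rfl⟩, fun j => ⟨j, rfl⟩⟩
  obtain ⟨⟨a, b, c⟩, -, he⟩ := Finset.mem_biUnion.1 he
  simp only [Finset.mem_insert, Finset.mem_singleton] at he
  rcases he with rfl | rfl | rfl <;>
    simp only [Finset.image_insert, Finset.image_singleton]
  · exact triple_inl_mem_F5Stss hm (by simp) (by simp) (by simp)
  · exact triple_inl_mem_F5Stss hm (by simp) (by simp) (by simp)
  · exact triple_inr_mem_F5Stss hm c (h0 a) (h1 b)
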